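/- arXiv:2310.18802 — 2 statements merged into one kernel-verified Lean document; each statement's English description precedes it below -/
import Mathlib

section
/- Let N ≥ 1 and let v : ℝ^N → ℝ be twice continuously differentiable. Then ein(vI) = −((N−2)/2)·(Hess v − (Δv) I), where (Hess v)_{ij} = ∂_i∂_j v, Δv = Σ_i ∂_i∂_i v, and I is the identity matrix. (This is the Euclidean case of the identity 2 ein(vg) = −(N−2) S∇∇v established in the proof of Lemma 3.3 in Appendix A.) -/
open Matrix BigOperators

/-- Partial derivative `∂_i f` of a scalar field on `ℝ^N`. -/
noncomputable def pd {N : ℕ} (i : Fin N) (f : (Fin N → ℝ) → ℝ) (x : Fin N → ℝ) : ℝ :=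
  fderiv ℝ f x (Pi.single i 1)

/-- The (Euclidean) divergence of a matrix field: `(div σ)_i = Σ_j ∂_j σ_{ij}`. -/
noncomputable def divM {N : ℕ} (σ : (Fin N → ℝ) → Matrix (Fin N) (Fin N) ℝ)
    (x : Fin N → ℝ) : Fin N → ℝ :=
  fun i => ∑ j, pd j (fun y => σ y i j) x

/-- The symmetrized gradient of a covector field: `(def α)_{ij} = (1/2)(∂_i α_j + ∂_j α_i)`. -/
noncomputable def defM {N : ℕ} (α : (Fin N → ℝ) → (Fin N → ℝ))
    (x : Fin N → ℝ) : Matrix (Fin N) (Fin N) ℝ :=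
  Matrix.of fun i j => (pd i (fun y => α y j) x + pd j (fun y => α y i) x) / 2

/-- The componentwise Laplacian of a matrix field. -/
noncomputable def lapM {N : ℕ} (σ : (Fin N → ℝ) → Matrix (Fin N) (Fin N) ℝ)
    (x : Fin N → ℝ) : Matrix (Fin N) (Fin N) ℝ :=
  Matrix.of fun i j => ∑ k, pd k (fun y => pd k (fun z => σ z i j) y) x

/-- The Euclidean trace-halving operator `Jσ = σ − (1/2)(Tr σ) I`. -/
noncomputable def Jmat {N : ℕ} (σ : Matrix (Fin N) (Fin N) ℝ) : Matrix (Fin N) (Fin N) ℝ :=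
  σ - ((1 : ℝ)/2) • σ.trace • (1 : Matrix (Fin N) (Fin N) ℝ)

/-- The Euclidean covariant linearized Einstein operator
`ein σ = J(def(div(Jσ))) − (1/2) Δ(Jσ)`. -/
noncomputable def einOp {N : ℕ} (σ : (Fin N → ℝ) → Matrix (Fin N) (Fin N) ℝ)
    (x : Fin N → ℝ) : Matrix (Fin N) (Fin N) ℝ :=
  Jmat (defM (fun y => divM (fun z => Jmat (σ z)) y) x)
    - ((1 : ℝ)/2) • lapM (fun y => Jmat (σ y)) x

theorem pd_const_mul_aux {N : ℕ} (i : Fin N) (c : ℝ) (f : (Fin N → ℝ) → ℝ)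
    (hf : Differentiable ℝ f) (x : Fin N → ℝ) :
    pd i (fun y => c * f y) x = c * pd i f x := by
  unfold pd
  rw [fderiv_const_mul (hf x)]
  simp

theorem pd_differentiable_aux {N : ℕ} (i : Fin N) (v : (Fin N → ℝ) → ℝ)
    (hv : ContDiff ℝ 2 v) : Differentiable ℝ (fun y => pd i v y) := by
  have h : ContDiff ℝ 1 (fderiv ℝ v) := hv.fderiv_right (by norm_num)
  have h2 := h.differentiable (by norm_num)
  unfold pd
  fun_prop

theorem pd_comm_aux {N : ℕ} (i j : Fin N) (v : (Fin N → ℝ) → ℝ)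
    (hv : ContDiff ℝ 2 v) (x : Fin N → ℝ) :
    pd i (fun y => pd j v y) x = pd j (fun y => pd i v y) x := by
  have h : ContDiff ℝ 1 (fderiv ℝ v) := hv.fderiv_right (by norm_num)
  have h2 := h.differentiable (by norm_num)
  have hs : IsSymmSndFDerivAt ℝ v x :=
    hv.contDiffAt.isSymmSndFDerivAt (by simp)
  unfold pd
  rw [fderiv_clm_apply (h2 x) (by fun_prop), fderiv_clm_apply (h2 x) (by fun_prop)]
  simpa using hs.eq _ _

/-- for a `C²` scalar field `v` on `ℝ^N`,
`ein(vI) = −((N−2)/2)(Hess v − (Δv) I)` (the Euclidean case of the identity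
`2 ein(vg) = −(N−2) S∇∇v` from the proof of Lemma 3.3). -/
theorem einOp_smul_id (N : ℕ) (hN : 1 ≤ N) (v : (Fin N → ℝ) → ℝ)
    (hv : ContDiff ℝ 2 v) (x : Fin N → ℝ) :
    einOp (fun y => v y • (1 : Matrix (Fin N) (Fin N) ℝ)) x
      = (-(((N : ℝ) - 2)/2)) •
        ((Matrix.of fun i j => pd i (fun y => pd j v y) x)
          - (∑ i, pd i (fun y => pd i v y) x) • (1 : Matrix (Fin N) (Fin N) ℝ)) := by
  have hd : Differentiable ℝ v := hv.differentiable (by norm_num)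
  have hJ : ∀ (z : Fin N → ℝ) (i j : Fin N),
      Jmat (v z • (1 : Matrix (Fin N) (Fin N) ℝ)) i j
        = ((1 - (N : ℝ) / 2) * (1 : Matrix (Fin N) (Fin N) ℝ) i j) * v z := by
    intro z i j
    simp [Jmat, Matrix.trace_smul]
    ring
  have hdiv : ∀ (y : Fin N → ℝ) (i : Fin N),
      divM (fun z => Jmat (v z • (1 : Matrix (Fin N) (Fin N) ℝ))) y i
        = (1 - (N : ℝ) / 2) * pd i v y := by
    intro y i
    simp only [divM, hJ, pd_const_mul_aux _ _ _ hd]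
    simp [Matrix.one_apply]
  have hdef : defM (fun y => divM (fun z => Jmat (v z • (1 : Matrix (Fin N) (Fin N) ℝ))) y) x
      = (1 - (N : ℝ) / 2) • (Matrix.of fun i j => pd i (fun y => pd j v y) x) := by
    ext i j
    simp only [defM, hdiv, Matrix.of_apply, Matrix.smul_apply, smul_eq_mul]
    rw [pd_const_mul_aux _ _ _ (pd_differentiable_aux j v hv),
      pd_const_mul_aux _ _ _ (pd_differentiable_aux i v hv), pd_comm_aux j i v hv]
    ring
  have hlap : lapM (fun z => Jmat (v z • (1 : Matrix (Fin N) (Fin N) ℝ))) x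
      = (1 - (N : ℝ) / 2) • (∑ i, pd i (fun y => pd i v y) x) •
        (1 : Matrix (Fin N) (Fin N) ℝ) := by
    ext i j
    simp only [lapM, hJ, Matrix.of_apply, Matrix.smul_apply, smul_eq_mul,
      pd_const_mul_aux _ _ _ hd]
    simp only [pd_const_mul_aux _ _ _ (pd_differentiable_aux _ v hv), ← Finset.mul_sum]
    ring
  unfold einOp
  rw [hdef, hlap]
  ext i j
  simp [Jmat, Matrix.trace]
  simp only [← Finset.mul_sum]
  ring
end

section
/- Let N ≥ 2 and let {n, ν, τ_1, …, τ_{N−2}} be an orthonormal basis of Euclidean ℝ^N, and set K_i := ν τ_iᵀ − τ_i νᵀ and L_i := τ_i nᵀ − n τ_iᵀ for 1 ≤ i ≤ N−2. Then for all N×N real symmetric matrices σ, ρ: 2 (Jσ n)·(Jρ ν) = Tr[ ( σ(nνᵀ − νnᵀ) − Σ_{i=1}^{N−2} K_i σ L_i ) ρ ]. (This is the identity 2 Jσ(n,·)·Jρ(ν,·) = Tr(Bρ) with B = σ(nνᵀ − νnᵀ) − Σ_i K_i σ L_i derived in the codimension-2 part of the proof of Lemma 4.1 in Appendix B.) -/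
open Matrix BigOperators

theorem codim2_complete (N : ℕ) (hN : 2 ≤ N)
    (n ν : Fin N → ℝ) (τ : Fin (N - 2) → Fin N → ℝ)
    (hnn : n ⬝ᵥ n = 1) (hνν : ν ⬝ᵥ ν = 1) (hττ : ∀ i, τ i ⬝ᵥ τ i = 1)
    (hnν : n ⬝ᵥ ν = 0) (hnτ : ∀ i, n ⬝ᵥ τ i = 0) (hντ : ∀ i, ν ⬝ᵥ τ i = 0)
    (hττ' : ∀ i j, i ≠ j → τ i ⬝ᵥ τ j = 0) :
    vecMulVec n n + (vecMulVec ν ν + ∑ i, vecMulVec (τ i) (τ i)) = 1 := by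
  let Q : Matrix (Option (Option (Fin (N - 2)))) (Fin N) ℝ :=
    fun o => o.elim n (fun o' => o'.elim ν τ)
  have h1 : Q * Qᵀ = 1 := by
    ext a b
    change Q a ⬝ᵥ Q b = _
    rcases a with _ | _ | a <;> rcases b with _ | _ | b <;>
      simp [Q, Matrix.one_apply, hnn, hνν, hnν, hnτ, hντ, dotProduct_comm ν n,
        dotProduct_comm (τ _) n, dotProduct_comm (τ _) ν]
    by_cases hab : a = b
    · subst hab; simp [hττ]
    · simp [hab, hττ' a b hab]
  have e : Option (Option (Fin (N - 2))) ≃ Fin N :=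
    Fintype.equivOfCardEq (by simp; omega)
  have h2 : Qᵀ * Q = 1 := (Matrix.mul_eq_one_comm_of_equiv e).1 h1
  rw [← h2]
  ext i j
  rw [Matrix.mul_apply]
  simp [Fintype.sum_option, Q, vecMulVec_apply, Matrix.sum_apply]
  rfl

theorem trace_vmv {N : ℕ} (A : Matrix (Fin N) (Fin N) ℝ) (a b : Fin N → ℝ) :
    (A * vecMulVec a b).trace = b ⬝ᵥ A *ᵥ a := by
  rw [Matrix.mul_vecMulVec, Matrix.trace_vecMulVec, dotProduct_comm]

theorem trace_KL {N : ℕ} (σ ρ : Matrix (Fin N) (Fin N) ℝ) (a b c d : Fin N → ℝ) :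
    (vecMulVec a b * σ * vecMulVec c d * ρ).trace = (b ⬝ᵥ σ *ᵥ c) * (d ⬝ᵥ ρ *ᵥ a) := by
  rw [Matrix.mul_assoc (vecMulVec a b), Matrix.mul_vecMulVec, Matrix.vecMulVec_mul_vecMulVec,
    Matrix.trace_mul_comm, trace_vmv, smul_dotProduct, smul_eq_mul]

theorem symm_swap {N : ℕ} (σ : Matrix (Fin N) (Fin N) ℝ) (h : σ.IsSymm) (a b : Fin N → ℝ) :
    a ⬝ᵥ σ *ᵥ b = b ⬝ᵥ σ *ᵥ a := by
  rw [dotProduct_mulVec, ← mulVec_transpose, h.eq, dotProduct_comm]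

/-- the identity `2 Jσ(n,·)·Jρ(ν,·) = Tr(Bρ)` with
`B = σ(nνᵀ − νnᵀ) − Σ_i K_i σ L_i`, `K_i = ντ_iᵀ − τ_iνᵀ`, `L_i = τ_inᵀ − nτ_iᵀ`, for an
orthonormal basis `{n, ν, τ_1, …, τ_{N−2}}` of Euclidean `ℝ^N` (proof of Lemma 4.1). -/
theorem codim2_matrix_identity (N : ℕ) (hN : 2 ≤ N)
    (n ν : Fin N → ℝ) (τ : Fin (N - 2) → Fin N → ℝ)
    (hnn : n ⬝ᵥ n = 1) (hνν : ν ⬝ᵥ ν = 1) (hττ : ∀ i, τ i ⬝ᵥ τ i = 1)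
    (hnν : n ⬝ᵥ ν = 0) (hnτ : ∀ i, n ⬝ᵥ τ i = 0) (hντ : ∀ i, ν ⬝ᵥ τ i = 0)
    (hττ' : ∀ i j, i ≠ j → τ i ⬝ᵥ τ j = 0)
    (σ ρ : Matrix (Fin N) (Fin N) ℝ) (hσ : σ.IsSymm) (hρ : ρ.IsSymm) :
    2 * ((Jmat σ) *ᵥ n ⬝ᵥ (Jmat ρ) *ᵥ ν)
      = ((σ * (vecMulVec n ν - vecMulVec ν n)
          - ∑ i, (vecMulVec ν (τ i) - vecMulVec (τ i) ν) * σ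
              * (vecMulVec (τ i) n - vecMulVec n (τ i))) * ρ).trace := by
  have hc := codim2_complete N hN n ν τ hnn hνν hττ hnν hnτ hντ hττ'
  have htr : ∀ A : Matrix (Fin N) (Fin N) ℝ,
      ∑ i, τ i ⬝ᵥ A *ᵥ τ i = A.trace - n ⬝ᵥ A *ᵥ n - ν ⬝ᵥ A *ᵥ ν := by
    intro A
    have h := congrArg (fun M => (A * M).trace) hc
    simp only [Matrix.mul_add, Matrix.mul_sum, Matrix.trace_add, Matrix.trace_sum, trace_vmv,
      Matrix.mul_one] at h
    linarith
  have hpar : ∀ x y : Fin N → ℝ,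
      ∑ i, (τ i ⬝ᵥ x) * (τ i ⬝ᵥ y) = x ⬝ᵥ y - (n ⬝ᵥ x) * (n ⬝ᵥ y) - (ν ⬝ᵥ x) * (ν ⬝ᵥ y) := by
    intro x y
    have h := htr (vecMulVec x y)
    simp only [Matrix.trace_vecMulVec, vecMulVec_mulVec, dotProduct_smul, op_smul_eq_smul,
      smul_eq_mul, dotProduct_comm y] at h
    rw [sub_sub, mul_comm (n ⬝ᵥ x), mul_comm (ν ⬝ᵥ x), ← sub_sub, ← h]
    exact Finset.sum_congr rfl fun i _ => mul_comm _ _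
  have hA : ∀ a b : Fin N → ℝ, (σ * vecMulVec a b * ρ).trace = σ *ᵥ a ⬝ᵥ ρ *ᵥ b := by
    intro a b
    rw [Matrix.mul_vecMulVec, Matrix.trace_mul_comm, trace_vmv, symm_swap ρ hρ]
  have hS : ∀ i, ((vecMulVec ν (τ i) - vecMulVec (τ i) ν) * σ
              * (vecMulVec (τ i) n - vecMulVec n (τ i)) * ρ).trace
      = (τ i ⬝ᵥ σ *ᵥ τ i) * (n ⬝ᵥ ρ *ᵥ ν) - (τ i ⬝ᵥ σ *ᵥ n) * (τ i ⬝ᵥ ρ *ᵥ ν)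
        - (τ i ⬝ᵥ σ *ᵥ ν) * (τ i ⬝ᵥ ρ *ᵥ n) + (n ⬝ᵥ σ *ᵥ ν) * (τ i ⬝ᵥ ρ *ᵥ τ i) := by
    intro i
    simp only [Matrix.sub_mul, Matrix.mul_sub, Matrix.trace_sub, trace_KL]
    rw [symm_swap σ hσ ν (τ i), symm_swap ρ hρ n (τ i), symm_swap σ hσ ν n]
    ring
  have hL : (Jmat σ) *ᵥ n ⬝ᵥ (Jmat ρ) *ᵥ ν = σ *ᵥ n ⬝ᵥ ρ *ᵥ ν
      - 1 / 2 * ρ.trace * (n ⬝ᵥ σ *ᵥ ν) - 1 / 2 * σ.trace * (n ⬝ᵥ ρ *ᵥ ν) := by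
    simp only [Jmat, Matrix.sub_mulVec, Matrix.smul_mulVec, Matrix.one_mulVec, sub_dotProduct,
      dotProduct_sub, smul_dotProduct, dotProduct_smul, smul_eq_mul, hnν]
    rw [dotProduct_comm (σ *ᵥ n) ν, symm_swap σ hσ ν n]
    ring
  rw [hL, Matrix.sub_mul, Matrix.trace_sub, Matrix.mul_sub, Matrix.sub_mul, Matrix.trace_sub,
    hA, hA, Matrix.sum_mul, Matrix.trace_sum, Finset.sum_congr rfl fun i _ => hS i,
    Finset.sum_add_distrib, Finset.sum_sub_distrib, Finset.sum_sub_distrib, ← Finset.sum_mul,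
    ← Finset.mul_sum, htr, htr, hpar, hpar, symm_swap σ hσ ν n, symm_swap ρ hρ ν n]
  ring
end
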